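/- arXiv:1703.08159 — 5 statements merged into one kernel-verified Lean document; each statement's English description precedes it below -/
import Mathlib

section
/- Let p>−1 be real and let q, α be complex. Then for every x with 0<x<1, ϑ_α^{(p,q)}(x) = ϑ_{−α}^{(p,q)}(x); that is, the Jacobi function is an even function of the parameter α. -/
open scoped Real
open Complex MeasureTheory Set ComplexConjugate

noncomputable section

/-- Pochhammer symbol `(a)ₙ = a (a+1) ⋯ (a+n−1)`. -/
def poch (a : ℂ) (n : ℕ) : ℂ := (ascPochhammer ℂ n).eval a

/-- Gauss hypergeometric series `₂F₁(a,b;c;z)`. -/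
def hyp2F1 (a b c z : ℂ) : ℂ :=
  ∑' n : ℕ, poch a n * poch b n / (poch c n * (n.factorial : ℂ)) * z ^ n

/-- Jacobi function `ϑ_α^{(p,q)}(x)` on `0 < x < 1`. -/
def thetaJ (p q α : ℂ) (x : ℝ) : ℂ :=
  (x : ℂ) ^ ((1 + p + q) / 2 + α) *
    hyp2F1 ((1 + p + q) / 2 + α) ((1 + p - q) / 2 + α) (1 + p) (1 - (x : ℂ))

lemma poch_succ (a : ℂ) (n : ℕ) : poch a (n + 1) = poch a n * (a + n) :=
  ascPochhammer_succ_eval n a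

lemma poch_ne_zero {c : ℂ} (hc : ∀ n : ℕ, c + n ≠ 0) (n : ℕ) : poch c n ≠ 0 := by
  induction n with
  | zero => simp [poch]
  | succ n ih => rw [poch_succ]; exact mul_ne_zero ih (hc n)

lemma one_add_natCast_ne_zero (n : ℕ) : (1 : ℂ) + n ≠ 0 := by
  rw [add_comm]; exact_mod_cast n.succ_ne_zero

/-- The Gauss hypergeometric series as a formal power series. -/
def hypSeries (a b c : ℂ) : PowerSeries ℂ :=
  PowerSeries.mk fun n => poch a n * poch b n / (poch c n * (n.factorial : ℂ))

lemma constantCoeff_hypSeries (a b c : ℂ) :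
    PowerSeries.constantCoeff (hypSeries a b c) = 1 := by
  simp [hypSeries, poch, ← PowerSeries.coeff_zero_eq_constantCoeff_apply,
    - PowerSeries.coeff_zero_eq_constantCoeff]

lemma coeff_succ_hypSeries (a b : ℂ) {c : ℂ} (hc : ∀ n : ℕ, c + n ≠ 0) (n : ℕ) :
    ((n : ℂ) + 1) * (c + n) * PowerSeries.coeff (n + 1) (hypSeries a b c) =
      (a + n) * (b + n) * PowerSeries.coeff n (hypSeries a b c) := by
  have h1 := poch_ne_zero hc n
  have h2 := hc n
  have h3 : (n.factorial : ℂ) ≠ 0 := by exact_mod_cast n.factorial_ne_zero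
  have h4 : (n : ℂ) + 1 ≠ 0 := by exact_mod_cast n.succ_ne_zero
  simp only [hypSeries, PowerSeries.coeff_mk, poch_succ, Nat.factorial_succ]
  push_cast
  field_simp

lemma hyp2F1_eq_tsum (a b c z : ℂ) :
    hyp2F1 a b c z = ∑' n : ℕ, PowerSeries.coeff n (hypSeries a b c) * z ^ n := by
  simp [hyp2F1, hypSeries]

lemma tendsto_add_natCast_div (a b : ℂ) :
    Filter.Tendsto (fun n : ℕ => (a + n) / (b + n)) Filter.atTop (nhds 1) := by
  simpa using tendsto_add_mul_div_add_mul_atTop_nhds a b 1 (one_ne_zero (α := ℂ))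

lemma summable_norm_hypSeries (a b : ℂ) {c z : ℂ} (hc : ∀ n : ℕ, c + n ≠ 0) (hz : ‖z‖ < 1) :
    Summable fun n : ℕ => ‖PowerSeries.coeff n (hypSeries a b c) * z ^ n‖ := by
  obtain ⟨r, hzr, hr⟩ := exists_between hz
  refine summable_of_ratio_norm_eventually_le hr ?_
  have hlim : Filter.Tendsto (fun n : ℕ => ‖(a + n) / (c + n) * ((b + n) / (1 + n)) * z‖)
      Filter.atTop (nhds ‖z‖) := by
    simpa using (((tendsto_add_natCast_div a c).mul
      (tendsto_add_natCast_div b 1)).mul_const z).norm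
  filter_upwards [hlim.eventually (ge_mem_nhds hzr)] with n hn
  have h2 := hc n
  have h4 := one_add_natCast_ne_zero n
  have hrec := coeff_succ_hypSeries a b hc n
  have key : PowerSeries.coeff (n + 1) (hypSeries a b c) * z ^ (n + 1) =
      ((a + n) / (c + n) * ((b + n) / (1 + n)) * z) *
        (PowerSeries.coeff n (hypSeries a b c) * z ^ n) := by
    field_simp
    linear_combination z ^ (n + 1) * hrec
  rw [norm_norm, norm_norm, key, norm_mul]
  gcongr

/-- The Euler operator `X d/dX` on formal power series. -/
def eulerOp : Derivation ℂ (PowerSeries ℂ) (PowerSeries ℂ) :=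
  (PowerSeries.X : PowerSeries ℂ) • PowerSeries.derivative ℂ

lemma coeff_eulerOp (f : PowerSeries ℂ) (n : ℕ) :
    PowerSeries.coeff n (eulerOp f) = n * PowerSeries.coeff n f := by
  cases n with
  | zero => simp [eulerOp]
  | succ n =>
    simp [eulerOp, PowerSeries.coeff_succ_X_mul, PowerSeries.coeff_derivative, mul_comm]

lemma constantCoeff_eulerOp (f : PowerSeries ℂ) :
    PowerSeries.constantCoeff (eulerOp f) = 0 := by
  simp [eulerOp]

lemma eulerOp_X : eulerOp PowerSeries.X = PowerSeries.X := by
  simp [eulerOp]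

/-- The hypergeometric differential equation for formal power series. -/
def IsHypSolution (a b c : ℂ) (f : PowerSeries ℂ) : Prop :=
  eulerOp (eulerOp f) + (PowerSeries.C c - 1) * eulerOp f =
    PowerSeries.X * (eulerOp (eulerOp f) + (PowerSeries.C a + PowerSeries.C b) * eulerOp f +
      PowerSeries.C a * (PowerSeries.C b * f))

lemma isHypSolution_iff {a b c : ℂ} {f : PowerSeries ℂ} :
    IsHypSolution a b c f ↔ ∀ n : ℕ, ((n : ℂ) + 1) * (c + n) * PowerSeries.coeff (n + 1) f =
      (a + n) * (b + n) * PowerSeries.coeff n f := by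
  rw [IsHypSolution, PowerSeries.ext_iff]
  have hsucc (n : ℕ) : (PowerSeries.coeff (n + 1) (eulerOp (eulerOp f) +
        (PowerSeries.C c - 1) * eulerOp f) = PowerSeries.coeff (n + 1)
        (PowerSeries.X * (eulerOp (eulerOp f) + (PowerSeries.C a + PowerSeries.C b) * eulerOp f +
          PowerSeries.C a * (PowerSeries.C b * f)))) ↔
      ((n : ℂ) + 1) * (c + n) * PowerSeries.coeff (n + 1) f =
        (a + n) * (b + n) * PowerSeries.coeff n f := by
    simp only [PowerSeries.coeff_succ_X_mul, map_add, sub_mul, add_mul, map_sub,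
      PowerSeries.coeff_C_mul, coeff_eulerOp, one_mul]
    push_cast
    constructor <;> intro h <;> linear_combination h
  refine ⟨fun h n => (hsucc n).1 (h _), fun h n => ?_⟩
  cases n with
  | zero => simp [constantCoeff_eulerOp]
  | succ n => exact (hsucc n).2 (h n)

lemma IsHypSolution.ext {a b c : ℂ} (hc : ∀ n : ℕ, c + n ≠ 0) {f g : PowerSeries ℂ}
    (hf : IsHypSolution a b c f) (hg : IsHypSolution a b c g)
    (h0 : PowerSeries.coeff 0 f = PowerSeries.coeff 0 g) : f = g := by
  ext n
  induction n with
  | zero => exact h0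
  | succ n ih =>
    have h4 : (n : ℂ) + 1 ≠ 0 := by exact_mod_cast n.succ_ne_zero
    refine mul_left_cancel₀ (mul_ne_zero h4 (hc n)) ?_
    rw [isHypSolution_iff.1 hf, isHypSolution_iff.1 hg, ih]

lemma eulerOp_hypSeries_one_one (s : ℂ) :
    eulerOp (hypSeries (-s) 1 1) = PowerSeries.X * (eulerOp (hypSeries (-s) 1 1) -
      PowerSeries.C s * hypSeries (-s) 1 1) := by
  ext n
  cases n with
  | zero => simp [constantCoeff_eulerOp]
  | succ n =>
    have h := coeff_succ_hypSeries (-s) 1 one_add_natCast_ne_zero n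
    refine mul_left_cancel₀ (one_add_natCast_ne_zero n) ?_
    simp only [PowerSeries.coeff_succ_X_mul, map_sub, PowerSeries.coeff_C_mul, coeff_eulerOp]
    push_cast
    linear_combination h

/-- **Euler's transformation** as an identity of formal power series. -/
theorem hypSeries_euler (a b : ℂ) {c : ℂ} (hc : ∀ n : ℕ, c + n ≠ 0) :
    hypSeries a b c =
      hypSeries (-(c - a - b)) 1 1 * hypSeries (c - a) (c - b) c := by
  refine IsHypSolution.ext hc (isHypSolution_iff.2 (coeff_succ_hypSeries a b hc)) ?_ ?_
  · have hF : IsHypSolution (c - a) (c - b) c _ :=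
      isHypSolution_iff.2 (coeff_succ_hypSeries (c - a) (c - b) hc)
    have hB := eulerOp_hypSeries_one_one (c - a - b)
    have hDB := congrArg eulerOp hB
    have hC : ∀ r : ℂ, eulerOp (PowerSeries.C r) = 0 := fun r => by simp [eulerOp]
    generalize hypSeries (-(c - a - b)) 1 1 = B at *
    generalize hypSeries (c - a) (c - b) c = F at *
    simp only [IsHypSolution, Derivation.leibniz, map_add, map_sub, smul_eq_mul, hC,
      eulerOp_X] at *
    linear_combination F * hDB + 2 * eulerOp F * hB + B * hF + (PowerSeries.C c - 1) * F * hB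
  · simp [constantCoeff_hypSeries]

lemma hyp2F1_one_one (s : ℂ) {z : ℂ} (hz : ‖z‖ < 1) : hyp2F1 (-s) 1 1 z = (1 - z) ^ s := by
  have h := (Complex.one_add_cpow_hasFPowerSeriesOnBall_zero (a := s)).hasSum (y := -z)
    (by rwa [mem_eball_zero_iff, enorm_neg, ← ofReal_norm, ENNReal.ofReal_lt_one])
  rw [zero_add, ← sub_eq_add_neg] at h
  rw [← h.tsum_eq]
  refine tsum_congr fun n => ?_
  have h3 : (n.factorial : ℂ) ≠ 0 := by exact_mod_cast n.factorial_ne_zero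
  have h1 : poch 1 n = n.factorial := ascPochhammer_eval_one ℂ n
  have hs : poch (-s) n = (-1) ^ n * (n.factorial * Ring.choose s n) := by
    rw [poch, ascPochhammer_eval_neg_eq_descPochhammer, ← nsmul_eq_mul,
      ← Ring.descPochhammer_eq_factorial_smul_choose,
      Polynomial.descPochhammer_smeval_eq_ascPochhammer, Polynomial.ascPochhammer_smeval_eq_eval,
      descPochhammer_eval_eq_ascPochhammer]
  simp only [binomialSeries_apply, List.ofFn_const, List.prod_replicate, smul_eq_mul, h1, hs]
  rw [neg_pow z]
  field_simp

/-- **Euler's transformation** of the Gauss hypergeometric function. -/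
theorem hyp2F1_euler (a b : ℂ) {c z : ℂ} (hc : ∀ n : ℕ, c + n ≠ 0) (hz : ‖z‖ < 1) :
    hyp2F1 a b c z = (1 - z) ^ (c - a - b) * hyp2F1 (c - a) (c - b) c z := by
  rw [← hyp2F1_one_one _ hz]
  simp only [hyp2F1_eq_tsum]
  rw [tsum_mul_tsum_eq_tsum_sum_antidiagonal_of_summable_norm
    (summable_norm_hypSeries _ _ one_add_natCast_ne_zero hz)
    (summable_norm_hypSeries _ _ hc hz), hypSeries_euler a b hc]
  refine tsum_congr fun n => ?_
  rw [PowerSeries.coeff_mul, Finset.sum_mul]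
  refine Finset.sum_congr rfl fun kl hkl => ?_
  rw [← Finset.HasAntidiagonal.mem_antidiagonal.1 hkl, pow_add]
  ring

theorem stmt1 (p : ℝ) (hp : -1 < p) (q α : ℂ) :
    ∀ x ∈ Ioo (0 : ℝ) 1, thetaJ (p : ℂ) q α x = thetaJ (p : ℂ) q (-α) x := by
  rintro x ⟨hx0, hx1⟩
  have hc : ∀ n : ℕ, (1 + p : ℂ) + n ≠ 0 := fun n => by
    have : (1 + p) + n ≠ 0 := ne_of_gt <| by
      have : (0 : ℝ) ≤ n := n.cast_nonneg
      linarith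
    exact_mod_cast this
  have hz : ‖1 - (x : ℂ)‖ < 1 := by
    rw [← ofReal_one, ← ofReal_sub, norm_real, Real.norm_eq_abs, abs_lt]
    constructor <;> linarith
  have hx : (x : ℂ) ≠ 0 := ofReal_ne_zero.2 hx0.ne'
  have hsymm (a b c z : ℂ) : hyp2F1 a b c z = hyp2F1 b a c z := by
    simp only [hyp2F1, mul_comm (poch a _)]
  rw [thetaJ, thetaJ, hyp2F1_euler _ _ hc hz, ← mul_assoc, sub_sub_cancel, ← cpow_add _ _ hx,
    hsymm]
  congr 2 <;> ring
end
end

section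
/- Let p>−1 be real and let q, α be complex. Then the map x ↦ ϑ_α^{(p,q)}(x) is twice differentiable on (0,1) and satisfies the eigenvalue equation (D_{p,q} ϑ_α^{(p,q)})(x) = (α² − (1+p+q)²/4) · ϑ_α^{(p,q)}(x) for all 0<x<1. -/
open scoped Real
open Complex MeasureTheory Set ComplexConjugate

noncomputable section

/-- The Jacobi operator `D_{p,q}` acting on functions on `(0,1)`. -/
def jacobiOp (p q : ℂ) (f : ℝ → ℂ) (x : ℝ) : ℂ :=
  -(p + q + (1 - q) * (x : ℂ)) * (x : ℂ) * deriv f x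
    + (1 - (x : ℂ)) * (x : ℂ) ^ 2 * deriv (deriv f) x

/-- If a power series converges absolutely on the open unit disc, so does its derivative. -/
lemma summable_norm_derivCoeff {u : ℕ → ℂ}
    (hu : ∀ r : ℝ, 0 ≤ r → r < 1 → Summable fun n => ‖u n‖ * r ^ n) (r : ℝ) (hr0 : 0 ≤ r)
    (hr1 : r < 1) : Summable fun n : ℕ => ‖((n : ℂ) + 1) * u (n + 1)‖ * r ^ n := by
  obtain ⟨s, hrs, hs1⟩ := exists_between hr1
  have hs0 : 0 < s := hr0.trans_lt hrs
  have hq : ‖r / s‖ < 1 := by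
    rw [Real.norm_of_nonneg (by positivity), div_lt_one hs0]
    exact hrs
  obtain ⟨C, hC⟩ : ∃ C, ∀ n, ‖u n‖ * s ^ n ≤ C := by
    obtain ⟨C, hC⟩ := (hu s hs0.le hs1).tendsto_atTop_zero.bddAbove_range
    exact ⟨C, fun n => hC ⟨n, rfl⟩⟩
  have h1 := (summable_pow_mul_geometric_of_norm_lt_one 1 hq).add
    (summable_geometric_of_norm_lt_one hq)
  refine Summable.of_nonneg_of_le (fun n => by positivity) (fun n => ?_) (h1.mul_left (C / s))
  have h2 : ‖(n : ℂ) + 1‖ = (n : ℝ) + 1 := by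
    exact_mod_cast Complex.norm_natCast (n + 1)
  rw [norm_mul, h2]
  calc ((n : ℝ) + 1) * ‖u (n + 1)‖ * r ^ n
      = (‖u (n + 1)‖ * s ^ (n + 1)) * (((n : ℝ) + 1) * (r / s) ^ n / s) := by
        rw [div_pow, pow_succ s n]; field_simp
    _ ≤ C * (((n : ℝ) + 1) * (r / s) ^ n / s) := by gcongr; exact hC (n + 1)
    _ = _ := by ring

lemma summable_powerSeries {u : ℕ → ℂ}
    (hu : ∀ r : ℝ, 0 ≤ r → r < 1 → Summable fun n => ‖u n‖ * r ^ n) {z : ℂ} (hz : ‖z‖ < 1) :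
    Summable fun n => u n * z ^ n :=
  Summable.of_norm (by simpa using hu ‖z‖ (norm_nonneg z) hz)

/-- Termwise differentiation of a power series inside the unit disc. -/
lemma hasDerivAt_powerSeries {u : ℕ → ℂ}
    (hu : ∀ r : ℝ, 0 ≤ r → r < 1 → Summable fun n => ‖u n‖ * r ^ n) {z : ℂ} (hz : ‖z‖ < 1) :
    HasDerivAt (fun w => ∑' n, u n * w ^ n)
      (∑' n : ℕ, ((n : ℂ) + 1) * u (n + 1) * z ^ n) z := by
  obtain ⟨r, hzr, hr1⟩ := exists_between hz
  have hr0 : 0 ≤ r := (norm_nonneg z).trans hzr.le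
  have key := summable_norm_derivCoeff hu r hr0 hr1
  have hbound : Summable fun n : ℕ => ‖u n‖ * (n * r ^ (n - 1)) := by
    rw [← summable_nat_add_iff 1]
    refine key.congr fun n => ?_
    have h2 : ‖(n : ℂ) + 1‖ = (n : ℝ) + 1 := by
      exact_mod_cast Complex.norm_natCast (n + 1)
    rw [norm_mul, h2, Nat.add_sub_cancel]
    push_cast
    ring
  have hmain := hasDerivAt_tsum_of_isPreconnected (g := fun n w => u n * w ^ n)
    (g' := fun n w => u n * (n * w ^ (n - 1))) (y₀ := 0) (y := z) hbound
    (Metric.isOpen_ball (x := (0 : ℂ)) (ε := r)) (convex_ball (0 : ℂ) r).isPreconnected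
    (fun n w _ => (hasDerivAt_pow n w).const_mul (u n))
    (fun n w hw => by
      have hw' : ‖w‖ ≤ r := by simpa using (mem_ball_zero_iff.mp hw).le
      rw [norm_mul, norm_mul, norm_pow, Complex.norm_natCast]
      gcongr)
    (by simpa using hr0.lt_of_ne (by rintro rfl; exact absurd hzr (norm_nonneg z).not_gt))
    (summable_powerSeries hu (by simp)) (by simpa using hzr)
  have hsum : Summable fun n : ℕ => u n * (n * z ^ (n - 1)) := by
    refine Summable.of_norm_bounded hbound fun n => ?_
    rw [norm_mul, norm_mul, norm_pow, Complex.norm_natCast]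
    gcongr
  have heq : ∑' n : ℕ, u n * (n * z ^ (n - 1)) = ∑' n : ℕ, ((n : ℂ) + 1) * u (n + 1) * z ^ n := by
    rw [hsum.tsum_eq_zero_add]
    simp only [Nat.cast_zero, zero_mul, mul_zero, zero_add, Nat.add_sub_cancel]
    refine tsum_congr fun n => ?_
    push_cast
    ring
  exact heq ▸ hmain

lemma hasSum_of_shift {w : ℕ → ℂ} (h0 : w 0 = 0) {z S : ℂ}
    (h : HasSum (fun n => w (n + 1) * z ^ n) S) : HasSum (fun n => w n * z ^ n) (z * S) := by
  rw [← hasSum_nat_add_iff' 1]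
  simpa [h0, pow_succ, mul_assoc, mul_comm, mul_left_comm] using h.mul_left z

/-- Power series form of the hypergeometric equation: a two-term recurrence for the coefficients
gives the Gauss differential equation. -/
lemma gauss_equation_of_recurrence {a b c : ℂ} {u : ℕ → ℂ}
    (hu : ∀ r : ℝ, 0 ≤ r → r < 1 → Summable fun n => ‖u n‖ * r ^ n)
    (hrec : ∀ n : ℕ, (c + n) * (n + 1) * u (n + 1) = (a + n) * (b + n) * u n)
    {z : ℂ} (hz : ‖z‖ < 1) :
    z * (1 - z) * (∑' n : ℕ, ((n : ℂ) + 1) * ((((n + 1 : ℕ) : ℂ) + 1) * u (n + 1 + 1)) * z ^ n)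
      + (c - (a + b + 1) * z) * (∑' n : ℕ, ((n : ℂ) + 1) * u (n + 1) * z ^ n)
      = a * b * ∑' n, u n * z ^ n := by
  have hu1 := summable_norm_derivCoeff hu
  have s0 := (summable_powerSeries hu hz).hasSum
  have s1 := (summable_powerSeries hu1 hz).hasSum
  have s2 := (summable_powerSeries (summable_norm_derivCoeff hu1) hz).hasSum
  have t1 : HasSum (fun n : ℕ => (n : ℂ) * u n * z ^ n) _ :=
    hasSum_of_shift (w := fun n : ℕ => (n : ℂ) * u n) (by simp) (by simpa using s1)
  have t2 : HasSum (fun n : ℕ => (n : ℂ) * (((n : ℂ) + 1) * u (n + 1)) * z ^ n) _ :=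
    hasSum_of_shift (w := fun n : ℕ => (n : ℂ) * (((n : ℂ) + 1) * u (n + 1))) (by simp)
      (by simpa using s2)
  have t3 : HasSum (fun n : ℕ => (n : ℂ) * ((n : ℂ) - 1) * u n * z ^ n) _ :=
    hasSum_of_shift (w := fun n : ℕ => (n : ℂ) * ((n : ℂ) - 1) * u n) (by simp)
      (t2.congr_fun (fun n => by push_cast; ring))
  have hzero := (((t2.sub t3).add (s1.mul_left c)).sub (t1.mul_left (a + b + 1))).sub
    (s0.mul_left (a * b))
  have h0 := hzero.unique (hasSum_zero.congr_fun fun n => by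
    linear_combination (z ^ n) * hrec n)
  push_cast
  linear_combination h0

/-- The coefficients of `₂F₁(a,b;c;·)`. -/
def hypCoeff (a b c : ℂ) (n : ℕ) : ℂ := poch a n * poch b n / (poch c n * (n.factorial : ℂ))

lemma hypCoeff_succ (a b c : ℂ) (n : ℕ) :
    hypCoeff a b c (n + 1) = (a + n) / (c + n) * ((b + n) / (1 + n)) * hypCoeff a b c n := by
  simp only [hypCoeff, poch_succ, Nat.factorial_succ, Nat.cast_mul, Nat.cast_add, Nat.cast_one,
    add_comm (n : ℂ) 1, div_eq_mul_inv, mul_inv]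
  ring

lemma summable_norm_hypCoeff (a b c : ℂ) (r : ℝ) (hr0 : 0 ≤ r)
    (hr1 : r < 1) : Summable fun n => ‖hypCoeff a b c n‖ * r ^ n := by
  have hlim : Filter.Tendsto (fun n : ℕ => ‖(a + n) / (c + n) * ((b + n) / (1 + n))‖ * r)
      Filter.atTop (nhds r) := by
    have h1 : Filter.Tendsto (fun n : ℕ => (a + n) / (c + n)) Filter.atTop (nhds 1) := by
      simpa using tendsto_add_mul_div_add_mul_atTop_nhds a c (1 : ℂ) one_ne_zero
    have h2 : Filter.Tendsto (fun n : ℕ => (b + n) / (1 + n)) Filter.atTop (nhds 1) := by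
      simpa using tendsto_add_mul_div_add_mul_atTop_nhds b 1 (1 : ℂ) one_ne_zero
    simpa using (h1.mul h2).norm.mul_const r
  obtain ⟨s, hrs, hs1⟩ := exists_between hr1
  refine summable_of_ratio_norm_eventually_le hs1 ?_
  filter_upwards [hlim.eventually_le_const hrs] with n hn
  have h : ‖‖hypCoeff a b c n‖ * r ^ n‖ = ‖hypCoeff a b c n‖ * r ^ n :=
    Real.norm_of_nonneg (by positivity)
  rw [h, Real.norm_of_nonneg (by positivity), hypCoeff_succ, norm_mul, pow_succ]
  calc _ = (‖(a + n) / (c + n) * ((b + n) / (1 + n))‖ * r) * (‖hypCoeff a b c n‖ * r ^ n) := by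
        ring
    _ ≤ _ := by gcongr

/-- `₂F₁(a,b;c;·)` is twice differentiable in the unit disc and solves the Gauss equation. -/
lemma exists_hasDerivAt_hyp2F1 {a b c : ℂ} (hc : ∀ n : ℕ, c + n ≠ 0) :
    ∃ F₁ F₂ : ℂ → ℂ, ∀ z : ℂ, ‖z‖ < 1 →
      HasDerivAt (hyp2F1 a b c) (F₁ z) z ∧ HasDerivAt F₁ (F₂ z) z ∧
      z * (1 - z) * F₂ z + (c - (a + b + 1) * z) * F₁ z = a * b * hyp2F1 a b c z := by
  have hu := summable_norm_hypCoeff a b c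
  refine ⟨_, _, fun z hz => ⟨hasDerivAt_powerSeries hu hz,
    hasDerivAt_powerSeries (summable_norm_derivCoeff hu) hz,
    gauss_equation_of_recurrence hu (fun n => ?_) hz⟩⟩
  have hn : (1 + n : ℂ) ≠ 0 := by
    rw [add_comm]; exact Nat.cast_add_one_ne_zero n
  have h1 := hc n
  rw [hypCoeff_succ]
  field_simp
  ring

/-- Derivative of `x ^ s * G (1 - x)` along the positive real axis. -/
lemma hasDerivAt_cpow_mul_comp_one_sub {G : ℂ → ℂ} {G' : ℂ} (s : ℂ) {x : ℝ} (hx : 0 < x)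
    (hG : HasDerivAt G G' (1 - (x : ℂ))) :
    HasDerivAt (fun y : ℝ => (y : ℂ) ^ s * G (1 - (y : ℂ)))
      (s * (x : ℂ) ^ (s - 1) * G (1 - (x : ℂ)) - (x : ℂ) ^ s * G') x := by
  have h1 : HasDerivAt (fun w : ℂ => w ^ s) (s * (x : ℂ) ^ (s - 1)) (x : ℂ) := by
    simpa using (hasDerivAt_id (x : ℂ)).cpow_const (c := s) (Or.inl (by simpa using hx))
  have h2 : HasDerivAt (fun w : ℂ => G (1 - w)) (-G') (x : ℂ) := hG.comp_const_sub 1 (x : ℂ)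
  have h3 := (h1.mul h2).comp_ofReal
  rwa [mul_neg, ← sub_eq_add_neg] at h3

theorem stmt2 (p : ℝ) (hp : -1 < p) (q α : ℂ) :
    ∀ x ∈ Ioo (0 : ℝ) 1,
      DifferentiableAt ℝ (fun y => thetaJ (p : ℂ) q α y) x ∧
      DifferentiableAt ℝ (deriv fun y => thetaJ (p : ℂ) q α y) x ∧
      jacobiOp (p : ℂ) q (fun y => thetaJ (p : ℂ) q α y) x
        = (α ^ 2 - (1 + (p : ℂ) + q) ^ 2 / 4) * thetaJ (p : ℂ) q α x := by
  intro x hx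
  have hc : ∀ n : ℕ, (1 + (p : ℂ)) + n ≠ 0 := fun n h => by
    have h' : 1 + p + n = 0 := by exact_mod_cast h
    have : (0 : ℝ) ≤ n := n.cast_nonneg
    linarith
  obtain ⟨F₁, F₂, hF⟩ := exists_hasDerivAt_hyp2F1 (a := (1 + p + q) / 2 + α)
    (b := (1 + p - q) / 2 + α) hc
  have hball : ∀ y ∈ Ioo (0 : ℝ) 1, ‖1 - (y : ℂ)‖ < 1 := fun y hy => by
    rw [← ofReal_one, ← ofReal_sub, norm_real, Real.norm_eq_abs, abs_lt]
    constructor <;> linarith [hy.1, hy.2]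
  have hd1 : ∀ y ∈ Ioo (0 : ℝ) 1, HasDerivAt (fun y => thetaJ (p : ℂ) q α y) _ y := fun y hy =>
    hasDerivAt_cpow_mul_comp_one_sub _ hy.1 (hF _ (hball y hy)).1
  have hd2 := (((hasDerivAt_cpow_mul_comp_one_sub ((1 + p + q) / 2 + α - 1) hx.1
    (hF _ (hball x hx)).1).const_mul ((1 + p + q) / 2 + α)).sub
    (hasDerivAt_cpow_mul_comp_one_sub ((1 + p + q) / 2 + α) hx.1 (hF _ (hball x hx)).2.1)
    ).congr_of_eventuallyEq (f₁ := deriv fun y => thetaJ (p : ℂ) q α y) (by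
      filter_upwards [isOpen_Ioo.mem_nhds hx] with y hy
      rw [(hd1 y hy).deriv]
      simp only [Pi.sub_apply]
      ring)
  refine ⟨(hd1 x hx).differentiableAt, hd2.differentiableAt, ?_⟩
  have hode := (hF _ (hball x hx)).2.2
  have hx0 : (x : ℂ) ≠ 0 := by exact_mod_cast hx.1.ne'
  rw [jacobiOp, hd2.deriv, (hd1 x hx).deriv, thetaJ]
  generalize hyp2F1 ((1 + p + q) / 2 + α) ((1 + p - q) / 2 + α) (1 + p) (1 - (x : ℂ)) = A at *
  generalize F₁ (1 - (x : ℂ)) = B at *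
  generalize F₂ (1 - (x : ℂ)) = C at *
  simp only [cpow_sub _ _ hx0, cpow_one]
  generalize (x : ℂ) ^ ((1 + p + q) / 2 + α) = P at *
  field_simp
  linear_combination (P * x * 16) * hode
end
end

section
/- Let p, q be complex and let f be twice differentiable on (0,1). Then for all x∈(0,1): (i) (D_{−p,q} f)(x) = ((1−x)/x)^p · [ (D_{p,q} g_p)(x) + p(1+q)·g_p(x) ], where g_p(y) = (y/(1−y))^p f(y); and (ii) (D_{p,−q} f)(x) = x^{−q} · [ (D_{p,q} h_q)(x) + (1+p)q·h_q(x) ], where h_q(y) = y^q f(y). -/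
open scoped Real
open Complex MeasureTheory Set ComplexConjugate

noncomputable section

theorem hasDerivAt_comp_cpow_const {g : ℝ → ℝ} {g' y : ℝ} (hg : HasDerivAt g g' y) (hy : 0 < g y)
    (r : ℂ) :
    HasDerivAt (fun z : ℝ => (g z : ℂ) ^ r) (r * g' / g y * (g y : ℂ) ^ r) y := by
  have hne : (g y : ℂ) ≠ 0 := by exact_mod_cast hy.ne'
  have h := ((hasDerivAt_id (g y : ℂ)).cpow_const (c := r)
    (Complex.ofReal_mem_slitPlane.2 hy)).comp y hg.ofReal_comp
  refine h.congr_deriv ?_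
  simp only [id, Complex.cpow_sub _ _ hne, Complex.cpow_one]
  field_simp

/-- The Jacobi operator on a product `w * f`, in terms of the logarithmic derivative `u` of `w`. -/
theorem jacobiOp_mul (p q : ℂ) {f w u : ℝ → ℂ} {u' : ℂ} {x : ℝ}
    (hf : ∀ y ∈ Ioo (0 : ℝ) 1, DifferentiableAt ℝ f y)
    (hf' : DifferentiableAt ℝ (deriv f) x)
    (hw : ∀ y ∈ Ioo (0 : ℝ) 1, HasDerivAt w (u y * w y) y)
    (hu : HasDerivAt u u' x) (hx : x ∈ Ioo (0 : ℝ) 1) :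
    jacobiOp p q (fun y => w y * f y) x
      = w x * (-(p + q + (1 - q) * (x : ℂ)) * x * (deriv f x + u x * f x)
        + (1 - (x : ℂ)) * (x : ℂ) ^ 2 *
          (deriv (deriv f) x + 2 * u x * deriv f x + (u' + u x ^ 2) * f x)) := by
  have h1 : ∀ y ∈ Ioo (0 : ℝ) 1,
      deriv (fun y => w y * f y) y = u y * w y * f y + w y * deriv f y :=
    fun y hy => ((hw y hy).mul (hf y hy).hasDerivAt).deriv
  have h2 : deriv (deriv (fun y => w y * f y)) x
      = (u' * w x + u x * (u x * w x)) * f x + u x * w x * deriv f x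
        + (u x * w x * deriv f x + w x * deriv (deriv f) x) := by
    rw [(Filter.eventuallyEq_of_mem (isOpen_Ioo.mem_nhds hx) h1).deriv_eq]
    exact (((hu.mul (hw x hx)).mul (hf x hx).hasDerivAt).add
      ((hw x hx).mul hf'.hasDerivAt)).deriv
  rw [jacobiOp, h1 x hx, h2]
  ring

theorem stmt4 (p q : ℂ) (f : ℝ → ℂ)
    (hf : ∀ x ∈ Ioo (0 : ℝ) 1, DifferentiableAt ℝ f x)
    (hf' : ∀ x ∈ Ioo (0 : ℝ) 1, DifferentiableAt ℝ (deriv f) x) :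
    ∀ x ∈ Ioo (0 : ℝ) 1,
      jacobiOp (-p) q f x
        = (((1 - x) / x : ℝ) : ℂ) ^ p *
            (jacobiOp p q (fun y => ((y / (1 - y) : ℝ) : ℂ) ^ p * f y) x
              + p * (1 + q) * ((x / (1 - x) : ℝ) : ℂ) ^ p * f x) ∧
      jacobiOp p (-q) f x
        = (x : ℂ) ^ (-q) *
            (jacobiOp p q (fun y => (y : ℂ) ^ q * f y) x
              + (1 + p) * q * (x : ℂ) ^ q * f x) := by
  intro x hx
  have hx0 : (x : ℂ) ≠ 0 := by exact_mod_cast hx.1.ne'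
  have hx1 : 1 - (x : ℂ) ≠ 0 := by exact_mod_cast (sub_pos.2 hx.2).ne'
  constructor
  · have hw : ∀ y ∈ Ioo (0 : ℝ) 1,
        HasDerivAt (fun y : ℝ => ((y / (1 - y) : ℝ) : ℂ) ^ p)
          (p / ((y : ℂ) * (1 - y)) * ((y / (1 - y) : ℝ) : ℂ) ^ p) y := by
      intro y hy
      have hy1 : 0 < 1 - y := sub_pos.2 hy.2
      have hy0' : (y : ℂ) ≠ 0 := by exact_mod_cast hy.1.ne'
      have hy1' : 1 - (y : ℂ) ≠ 0 := by exact_mod_cast hy1.ne'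
      have hg : HasDerivAt (fun z : ℝ => z / (1 - z)) _ y :=
        (hasDerivAt_id y).div ((hasDerivAt_id y).const_sub 1) hy1.ne'
      refine (hasDerivAt_comp_cpow_const hg (div_pos hy.1 hy1) p).congr_deriv ?_
      congr 1
      simp only [id]
      push_cast
      field_simp
      ring
    have hu : HasDerivAt (fun y : ℝ => p / ((y : ℂ) * (1 - y)))
        (-(p * (1 - 2 * x)) / ((x : ℂ) * (1 - x)) ^ 2) x := by
      have hid := (hasDerivAt_id x).ofReal_comp
      refine ((hasDerivAt_const x p).div (hid.mul (hid.const_sub 1))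
        (mul_ne_zero hx0 hx1)).congr_deriv ?_
      simp
      ring
    rw [jacobiOp_mul p q hf (hf' x hx) hw hu hx]
    have hinv : (((1 - x) / x : ℝ) : ℂ) ^ p * ((x / (1 - x) : ℝ) : ℂ) ^ p = 1 := by
      rw [← Complex.mul_cpow_ofReal_nonneg (div_pos (sub_pos.2 hx.2) hx.1).le
        (div_pos hx.1 (sub_pos.2 hx.2)).le, ← Complex.ofReal_mul,
        div_mul_div_cancel₀ hx.1.ne', div_self (sub_pos.2 hx.2).ne', Complex.ofReal_one,
        Complex.one_cpow]
    generalize (((1 - x) / x : ℝ) : ℂ) ^ p = a at *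
    generalize ((x / (1 - x) : ℝ) : ℂ) ^ p = b at *
    rw [jacobiOp]
    trans a * b * (-(-p + q + (1 - q) * (x : ℂ)) * x * deriv f x
      + (1 - (x : ℂ)) * (x : ℂ) ^ 2 * deriv (deriv f) x)
    · rw [hinv, one_mul]
    · field_simp
      ring
  · have hw : ∀ y ∈ Ioo (0 : ℝ) 1,
        HasDerivAt (fun y : ℝ => (y : ℂ) ^ q) (q / (y : ℂ) * (y : ℂ) ^ q) y := by
      intro y hy
      simpa using hasDerivAt_comp_cpow_const (hasDerivAt_id y) hy.1 q
    have hu : HasDerivAt (fun y : ℝ => q / (y : ℂ)) (-q / (x : ℂ) ^ 2) x := by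
      have hid := (hasDerivAt_id x).ofReal_comp
      refine ((hasDerivAt_const x q).div hid hx0).congr_deriv ?_
      simp
    rw [jacobiOp_mul p q hf (hf' x hx) hw hu hx]
    have hinv : (x : ℂ) ^ (-q) * (x : ℂ) ^ q = 1 := by
      rw [← Complex.cpow_add _ _ hx0, neg_add_cancel, Complex.cpow_zero]
    generalize (x : ℂ) ^ (-q) = a at *
    generalize (x : ℂ) ^ q = b at *
    rw [jacobiOp]
    trans a * b * (-(p + -q + (1 - -q) * (x : ℂ)) * x * deriv f x
      + (1 - (x : ℂ)) * (x : ℂ) ^ 2 * deriv (deriv f) x)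
    · rw [hinv, one_mul]
    · field_simp
      ring
end
end

section
/- Let d, Δ₁, Δ₂ be real, h=d/2, Δ₋=(Δ₁−Δ₂)/2, and let f be twice differentiable on (0,1). Then for all ρ∈(0,1): (1/4)·(D_bulk f)(ρ) = ((1−ρ)/ρ)^{Δ₋} · [ (D_{2Δ₋, h−1} g)(ρ) + Δ₋(Δ₋+h)·g(ρ) ], where g(y) = (y/(1−y))^{Δ₋} f(y). That is, the bulk Casimir operator is conjugate to the Jacobi operator with parameters (p,q)=(2Δ₋, h−1) shifted by the constant Δ₋(Δ₋+h). -/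
open scoped Real
open Complex MeasureTheory Set ComplexConjugate

noncomputable section

/-- The bulk Casimir operator `D_bulk` (with `h = d/2`, `Δm = Δ₋`). -/
def Dbulk (h Δm : ℝ) (f : ℝ → ℂ) (ρ : ℝ) : ℂ :=
  4 * (ρ : ℂ) ^ ((h + 1 : ℝ) : ℂ) *
      deriv (fun y : ℝ => (y : ℂ) ^ ((1 - h : ℝ) : ℂ) * (1 - (y : ℂ)) * deriv f y) ρ
    - 4 * (Δm : ℂ) ^ 2 * ((ρ : ℂ) / (1 - (ρ : ℂ))) * f ρ

theorem hasDerivAt_ofReal_cpow_of_pos (a : ℂ) {x : ℝ} (hx : 0 < x) :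
    HasDerivAt (fun y : ℝ => (y : ℂ) ^ a) (a * (x : ℂ) ^ a / x) x := by
  have h : HasDerivAt (fun z : ℂ => z ^ a) (a * (x : ℂ) ^ (a - 1) * 1) (x : ℂ) :=
    (hasDerivAt_id (x : ℂ)).cpow_const (Or.inl (by simpa using hx))
  have hx0 : (x : ℂ) ≠ 0 := by exact_mod_cast hx.ne'
  convert h.comp_ofReal using 1
  rw [cpow_sub _ _ hx0, cpow_one, mul_one, mul_div_assoc]

theorem hasDerivAt_div_one_sub_cpow (a : ℂ) {x : ℝ} (hx : x ∈ Ioo (0 : ℝ) 1) :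
    HasDerivAt (fun y : ℝ => ((y / (1 - y) : ℝ) : ℂ) ^ a)
      (a / (x * (1 - x)) * ((x / (1 - x) : ℝ) : ℂ) ^ a) x := by
  have h1 : 0 < 1 - x := sub_pos.2 hx.2
  have hu : HasDerivAt (fun y : ℝ => y / (1 - y)) ((1 * (1 - x) - x * (-1)) / (1 - x) ^ 2) x :=
    (hasDerivAt_id x).div ((hasDerivAt_id x).const_sub 1) h1.ne'
  have h := (hasDerivAt_ofReal_cpow_of_pos a (div_pos hx.1 h1)).scomp x hu
  have hx0 : (x : ℂ) ≠ 0 := by exact_mod_cast hx.1.ne'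
  have hx1 : (1 - x : ℂ) ≠ 0 := by exact_mod_cast h1.ne'
  refine h.congr_deriv ?_
  rw [real_smul]
  generalize ((x / (1 - x) : ℝ) : ℂ) ^ a = w
  push_cast
  field_simp
  ring

theorem stmt7 (d Δ₁ Δ₂ h Δm : ℝ) (hh : h = d / 2) (hm : Δm = (Δ₁ - Δ₂) / 2)
    (f : ℝ → ℂ)
    (hf : ∀ x ∈ Ioo (0 : ℝ) 1, DifferentiableAt ℝ f x)
    (hf' : ∀ x ∈ Ioo (0 : ℝ) 1, DifferentiableAt ℝ (deriv f) x) :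
    ∀ ρ ∈ Ioo (0 : ℝ) 1,
      (1 / 4 : ℂ) * Dbulk h Δm f ρ
        = (((1 - ρ) / ρ : ℝ) : ℂ) ^ ((Δm : ℝ) : ℂ) *
            (jacobiOp ((2 * Δm : ℝ) : ℂ) ((h - 1 : ℝ) : ℂ)
                (fun y => ((y / (1 - y) : ℝ) : ℂ) ^ ((Δm : ℝ) : ℂ) * f y) ρ
              + (Δm : ℂ) * ((Δm + h : ℝ) : ℂ) *
                  ((ρ / (1 - ρ) : ℝ) : ℂ) ^ ((Δm : ℝ) : ℂ) * f ρ) := by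
  intro ρ hρ
  have h1 : 0 < 1 - ρ := sub_pos.2 hρ.2
  have hρ0 : (ρ : ℂ) ≠ 0 := by exact_mod_cast hρ.1.ne'
  have hρ1 : (1 - ρ : ℂ) ≠ 0 := by exact_mod_cast h1.ne'
  have hid : HasDerivAt (fun y : ℝ => (y : ℂ)) 1 ρ := (hasDerivAt_id (ρ : ℂ)).comp_ofReal
  have hL := (((hasDerivAt_ofReal_cpow_of_pos ((1 - h : ℝ) : ℂ) hρ.1).mul
    (hid.const_sub 1)).mul (hf' ρ hρ).hasDerivAt).deriv
  have hg : ∀ x ∈ Ioo (0 : ℝ) 1,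
      HasDerivAt (fun y : ℝ => ((y / (1 - y) : ℝ) : ℂ) ^ (Δm : ℂ) * f y)
        ((Δm : ℂ) / (x * (1 - x)) * ((x / (1 - x) : ℝ) : ℂ) ^ (Δm : ℂ) * f x
          + ((x / (1 - x) : ℝ) : ℂ) ^ (Δm : ℂ) * deriv f x) x := fun x hx =>
    (hasDerivAt_div_one_sub_cpow (Δm : ℂ) hx).mul (hf x hx).hasDerivAt
  have hg1 := (hg ρ hρ).deriv
  have hw := hasDerivAt_div_one_sub_cpow (Δm : ℂ) hρ
  have hg2 := ((((((hasDerivAt_const ρ (Δm : ℂ)).div (hid.mul (hid.const_sub 1))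
    (mul_ne_zero hρ0 hρ1)).mul hw).mul (hf ρ hρ).hasDerivAt).add
    (hw.mul (hf' ρ hρ).hasDerivAt)).congr_of_eventuallyEq
    (Filter.eventually_of_mem (isOpen_Ioo.mem_nhds hρ) fun x hx => (hg x hx).deriv)).deriv
  have hpow : (ρ : ℂ) ^ ((h + 1 : ℝ) : ℂ) * (ρ : ℂ) ^ ((1 - h : ℝ) : ℂ) = (ρ : ℂ) ^ 2 := by
    rw [← cpow_add _ _ hρ0, ← cpow_ofNat]
    congr 1
    push_cast
    ring
  have hinv : (((1 - ρ) / ρ : ℝ) : ℂ) ^ (Δm : ℂ) * ((ρ / (1 - ρ) : ℝ) : ℂ) ^ (Δm : ℂ) = 1 := by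
    rw [← mul_cpow_ofReal_nonneg (div_pos h1 hρ.1).le (div_pos hρ.1 h1).le, ← ofReal_mul,
      div_mul_div_cancel₀ hρ.1.ne', div_self h1.ne', ofReal_one, one_cpow]
  unfold Dbulk jacobiOp
  rw [show deriv (fun y : ℝ => (y : ℂ) ^ ((1 - h : ℝ) : ℂ) * (1 - (y : ℂ)) * deriv f y) ρ = _
    from hL, hg1, hg2]
  simp only [Pi.mul_apply, Pi.div_apply]
  generalize (ρ : ℂ) ^ ((h + 1 : ℝ) : ℂ) = A at *
  generalize (ρ : ℂ) ^ ((1 - h : ℝ) : ℂ) = B at *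
  generalize (((1 - ρ) / ρ : ℝ) : ℂ) ^ (Δm : ℂ) = V at *
  generalize ((ρ / (1 - ρ) : ℝ) : ℂ) ^ (Δm : ℂ) = W at *
  generalize deriv (deriv f) ρ = f2 at *
  generalize deriv f ρ = f1 at *
  generalize f ρ = f0 at *
  push_cast
  trans A * B * (((1 - h) / ρ * (1 - ρ) - 1) * f1 + (1 - ρ) * f2)
    - (Δm : ℂ) ^ 2 * (ρ / (1 - ρ)) * f0
  · field_simp
    ring
  trans V * W * (ρ ^ 2 * (((1 - h) / ρ * (1 - ρ) - 1) * f1 + (1 - ρ) * f2)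
    - (Δm : ℂ) ^ 2 * (ρ / (1 - ρ)) * f0)
  · rw [hpow, hinv, one_mul]
  · field_simp
    ring
end
end

section
/- Let d>0 and Δ₁, Δ₂ be real with Δ₋>−1/2, Δ₊>h/2 and Δ₂<h+1/2, where h=d/2, Δ₊=(Δ₁+Δ₂)/2, Δ₋=(Δ₁−Δ₂)/2. Then for all purely imaginary α, ν, both integrals below converge absolutely and the duality relation K^bdy(α,ν|Δ₁,Δ₂) = K^blk(ν,α|d−Δ₂,d−Δ₁) holds, where K^bdy(α,ν|Δ₁,Δ₂) = ∫₀¹ w_bulk(ρ)·(ρ/(1−ρ))^{Δ₊}·Ψ_α^bulk(ρ)·Ψ_ν^bdy(ρ) dρ and K^blk(ν,α|Δ₁',Δ₂') = ∫₀¹ w_bdy(ρ)·((1−ρ)/ρ)^{(Δ₁'+Δ₂')/2}·Ψ_α^{bulk'}(ρ)·Ψ_ν^bdy(ρ) dρ, the primed partial wave Ψ^{bulk'} being built from (Δ₁',Δ₂')=(d−Δ₂,d−Δ₁) (note that (Δ₁'−Δ₂')/2 = Δ₋, so Ψ^{bulk'}=Ψ^bulk). -/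
open scoped Real
open Complex MeasureTheory Set ComplexConjugate

noncomputable section

/-- The bulk partial wave `Ψ_α^bulk(ρ) = ((1−ρ)/ρ)^{Δ₋} ϑ_α^{(2Δ₋, h−1)}(ρ)`. -/
def PsiBulk (h Δm : ℝ) (α : ℂ) (ρ : ℝ) : ℂ :=
  (((1 - ρ) / ρ : ℝ) : ℂ) ^ ((Δm : ℝ) : ℂ) * thetaJ ((2 * Δm : ℝ) : ℂ) ((h - 1 : ℝ) : ℂ) α ρ

/-- The boundary partial wave `Ψ_ν^bdy(ρ) = ϑ_ν^{(h−1, h−1)}(1−ρ)`. -/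
def PsiBdy (h : ℝ) (ν : ℂ) (ρ : ℝ) : ℂ :=
  thetaJ ((h - 1 : ℝ) : ℂ) ((h - 1 : ℝ) : ℂ) ν (1 - ρ)

/-- The bulk weight `w_bulk(ρ) = ρ^{−h−1}`. -/
def wbulk (h : ℝ) (ρ : ℝ) : ℂ := (ρ : ℂ) ^ ((-h - 1 : ℝ) : ℂ)

/-- The boundary weight `w_bdy(ρ) = ρ^{h−1}(1−ρ)^{−2h}`. -/
def wbdy (h : ℝ) (ρ : ℝ) : ℂ :=
  (ρ : ℂ) ^ ((h - 1 : ℝ) : ℂ) * ((1 - ρ : ℝ) : ℂ) ^ ((-2 * h : ℝ) : ℂ)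

/-- The general coefficient of the Gauss series. -/
def hyp2F1Coeff (a b c : ℂ) (n : ℕ) : ℂ :=
  poch a n * poch b n / (poch c n * (n.factorial : ℂ))

theorem poch_succ_eq_prod (a : ℂ) (n : ℕ) :
    poch a (n + 1) = ∏ j ∈ Finset.range (n + 1), (a + j) := by
  rw [poch]
  induction n with
  | zero => simp
  | succ n ih => rw [ascPochhammer_succ_eval, ih, Finset.prod_range_succ _ (n + 1)]

theorem exists_norm_poch_succ_le (a : ℂ) : ∃ C : ℝ, ∀ᶠ n : ℕ in Filter.atTop,
    ‖poch a (n + 1)‖ ≤ C * ((n : ℝ) ^ a.re * n.factorial) := by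
  by_cases ha : ∃ m : ℕ, a = -m
  · obtain ⟨m, rfl⟩ := ha
    refine ⟨0, Filter.eventually_atTop.2 ⟨m, fun n hn => ?_⟩⟩
    have : poch (-(m : ℂ)) (n + 1) = 0 := by
      rw [poch_succ_eq_prod]
      exact Finset.prod_eq_zero (Finset.mem_range.2 (Nat.lt_succ_of_le hn)) (by simp)
    simp [this]
  · push Not at ha
    have hG := Complex.Gamma_ne_zero ha
    have hlim := ((Complex.GammaSeq_tendsto_Gamma a).inv₀ hG).norm
    refine ⟨‖(Complex.Gamma a)⁻¹‖ + 1, ?_⟩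
    filter_upwards [hlim.eventually_le_const (lt_add_one _), Filter.eventually_gt_atTop 0]
      with n hn hn0
    have hn0' : (0 : ℝ) < n := Nat.cast_pos.2 hn0
    have hpow : ‖(n : ℂ) ^ a‖ = (n : ℝ) ^ a.re := by
      simpa using Complex.norm_cpow_eq_rpow_re_of_pos hn0' a
    have hpos : 0 < (n : ℝ) ^ a.re * n.factorial := by positivity
    rw [Complex.GammaSeq, ← poch_succ_eq_prod, inv_div, norm_div, norm_mul, hpow,
      Complex.norm_natCast, div_le_iff₀ hpos] at hn
    exact hn

theorem exists_le_norm_poch_succ (c : ℂ) (hc : ∀ m : ℕ, c ≠ -m) :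
    ∃ C : ℝ, 0 < C ∧ ∀ᶠ n : ℕ in Filter.atTop,
      C * ((n : ℝ) ^ c.re * n.factorial) ≤ ‖poch c (n + 1)‖ := by
  have hG := Complex.Gamma_ne_zero hc
  have hlim := ((Complex.GammaSeq_tendsto_Gamma c).inv₀ hG).norm
  have hpos : 0 < ‖(Complex.Gamma c)⁻¹‖ := norm_pos_iff.2 (inv_ne_zero hG)
  refine ⟨‖(Complex.Gamma c)⁻¹‖ / 2, half_pos hpos, ?_⟩
  filter_upwards [hlim.eventually_const_le (half_lt_self hpos), Filter.eventually_gt_atTop 0]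
    with n hn hn0
  have hn0' : (0 : ℝ) < n := Nat.cast_pos.2 hn0
  have hpow : ‖(n : ℂ) ^ c‖ = (n : ℝ) ^ c.re := by
    simpa using Complex.norm_cpow_eq_rpow_re_of_pos hn0' c
  have hpos : 0 < (n : ℝ) ^ c.re * n.factorial := by positivity
  rw [Complex.GammaSeq, ← poch_succ_eq_prod, inv_div, norm_div, norm_mul, hpow,
    Complex.norm_natCast, le_div_iff₀ hpos] at hn
  exact hn

/-- In the balanced case `Re (a + b) = Re c`, the Gauss coefficients are `O(1/n)`. -/
theorem exists_norm_hyp2F1Coeff_succ_le (a b c : ℂ) (hc : ∀ m : ℕ, c ≠ -m)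
    (habc : a.re + b.re = c.re) :
    ∃ C : ℝ, 0 ≤ C ∧ ∀ n : ℕ, ‖hyp2F1Coeff a b c (n + 1)‖ ≤ C / (n + 1) := by
  obtain ⟨A, hA⟩ := exists_norm_poch_succ_le a
  obtain ⟨B, hB⟩ := exists_norm_poch_succ_le b
  obtain ⟨D, hD0, hD⟩ := exists_le_norm_poch_succ c hc
  have hev : ∀ᶠ n : ℕ in Filter.atTop,
      ‖hyp2F1Coeff a b c (n + 1)‖ * (n + 1) ≤ A * B / D := by
    filter_upwards [hA, hB, hD, Filter.eventually_gt_atTop 0] with n ha hb hcn hn0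
    have hn0' : (0 : ℝ) < n := Nat.cast_pos.2 hn0
    have hf : (0 : ℝ) < n.factorial := by positivity
    have hlow : 0 < D * ((n : ℝ) ^ c.re * n.factorial) := by positivity
    have hfac : ‖((n + 1).factorial : ℂ)‖ = (n + 1) * n.factorial := by
      rw [Complex.norm_natCast, Nat.factorial_succ]; push_cast; ring
    rw [hyp2F1Coeff, norm_div, norm_mul, norm_mul, hfac]
    have hP : 0 < ‖poch c (n + 1)‖ := hlow.trans_le hcn
    calc ‖poch a (n + 1)‖ * ‖poch b (n + 1)‖ / (‖poch c (n + 1)‖ * ((n + 1) * n.factorial))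
          * (n + 1)
        = ‖poch a (n + 1)‖ * ‖poch b (n + 1)‖ / (‖poch c (n + 1)‖ * n.factorial) := by
          field_simp
      _ ≤ (A * ((n : ℝ) ^ a.re * n.factorial)) * (B * ((n : ℝ) ^ b.re * n.factorial)) /
          (D * ((n : ℝ) ^ c.re * n.factorial) * n.factorial) := by
          have h0 := (norm_nonneg _).trans ha
          have h1 := (norm_nonneg _).trans hb
          gcongr
      _ = A * B / D := by
          rw [← habc, Real.rpow_add hn0']
          have h1 : (0 : ℝ) < (n : ℝ) ^ a.re := by positivity
          have h2 : (0 : ℝ) < (n : ℝ) ^ b.re := by positivity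
          field_simp
  obtain ⟨N, hN⟩ := Filter.eventually_atTop.1 hev
  set S := ∑ k ∈ Finset.range N, ‖hyp2F1Coeff a b c (k + 1)‖ * ((k : ℝ) + 1) with hS
  have hS0 : 0 ≤ S := Finset.sum_nonneg fun k _ => by positivity
  refine ⟨max (A * B / D) S, le_max_of_le_right hS0, fun n => ?_⟩
  rw [le_div_iff₀ (by positivity)]
  rcases lt_or_ge n N with hn | hn
  · exact le_max_of_le_right (Finset.single_le_sum
      (f := fun k : ℕ => ‖hyp2F1Coeff a b c (k + 1)‖ * ((k : ℝ) + 1))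
      (fun k _ => by positivity) (Finset.mem_range.2 hn))
  · exact le_max_of_le_left (hN n hn)

theorem hyp2F1_balanced_bound (a b c : ℂ) (hc : ∀ m : ℕ, c ≠ -m)
    (habc : a.re + b.re = c.re) :
    ∃ C : ℝ, 0 ≤ C ∧ ∀ x : ℝ, 0 < x → x < 1 →
      Summable (fun n => hyp2F1Coeff a b c n * (x : ℂ) ^ n) ∧
      ‖hyp2F1 a b c x‖ ≤ 1 + C * -Real.log (1 - x) := by
  obtain ⟨C, hC0, hC⟩ := exists_norm_hyp2F1Coeff_succ_le a b c hc habc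
  refine ⟨C, hC0, fun x hx0 hx1 => ?_⟩
  have hlog := (Real.hasSum_pow_div_log_of_abs_lt_one
    (x := x) (by rw [abs_of_pos hx0]; exact hx1)).mul_left C
  have hle : ∀ n : ℕ, ‖hyp2F1Coeff a b c (n + 1) * (x : ℂ) ^ (n + 1)‖ ≤
      C * (x ^ (n + 1) / (n + 1)) := fun n => by
    rw [norm_mul, norm_pow, Complex.norm_real, Real.norm_of_nonneg hx0.le]
    calc _ ≤ C / (n + 1) * x ^ (n + 1) := by gcongr; exact hC n
      _ = _ := by ring
  have hsum : Summable (fun n => hyp2F1Coeff a b c n * (x : ℂ) ^ n) :=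
    (summable_nat_add_iff 1).1 (Summable.of_norm_bounded hlog.summable hle)
  refine ⟨hsum, ?_⟩
  have h0 : hyp2F1Coeff a b c 0 = 1 := by simp [hyp2F1Coeff, poch]
  change ‖∑' n, hyp2F1Coeff a b c n * (x : ℂ) ^ n‖ ≤ _
  rw [hsum.tsum_eq_zero_add, h0]
  refine (norm_add_le _ _).trans (add_le_add (by simp) (tsum_of_norm_bounded hlog hle))

theorem hyp2F1_balanced_rpow_bound (a b c : ℂ) (hc : ∀ m : ℕ, c ≠ -m)
    (habc : a.re + b.re = c.re) {ε : ℝ} (hε : 0 < ε) :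
    ∃ C : ℝ, 0 ≤ C ∧ ∀ x : ℝ, 0 < x → x < 1 →
      ‖hyp2F1 a b c x‖ ≤ C * (1 - x) ^ (-ε) := by
  obtain ⟨C, hC0, hC⟩ := hyp2F1_balanced_bound a b c hc habc
  refine ⟨1 + C / ε, by positivity, fun x hx0 hx1 => (hC x hx0 hx1).2.trans ?_⟩
  have h1 : 0 < 1 - x := sub_pos.2 hx1
  have hl := Real.log_le_rpow_div (x := (1 - x)⁻¹) (by positivity) hε
  rw [Real.log_inv, Real.inv_rpow h1.le, ← Real.rpow_neg h1.le] at hl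
  have h2 : 1 ≤ (1 - x) ^ (-ε) :=
    Real.one_le_rpow_of_pos_of_le_one_of_nonpos h1 (by linarith) (by linarith)
  calc _ ≤ (1 - x) ^ (-ε) + C * ((1 - x) ^ (-ε) / ε) := by gcongr
    _ = _ := by ring

theorem aestronglyMeasurable_hyp2F1_balanced (a b c : ℂ) (hc : ∀ m : ℕ, c ≠ -m)
    (habc : a.re + b.re = c.re) {g : ℝ → ℝ} (hg : Measurable g)
    (hmaps : MapsTo g (Ioo 0 1) (Ioo 0 1)) :
    AEStronglyMeasurable (fun ρ : ℝ => hyp2F1 a b c (g ρ)) (volume.restrict (Ioo 0 1)) := by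
  obtain ⟨C, -, hC⟩ := hyp2F1_balanced_bound a b c hc habc
  refine aestronglyMeasurable_of_tendsto_ae Filter.atTop
    (f := fun (N : ℕ) (ρ : ℝ) =>
      ∑ n ∈ Finset.range N, hyp2F1Coeff a b c n * ((g ρ : ℝ) : ℂ) ^ n) ?_ ?_
  · intro N
    exact Measurable.aestronglyMeasurable (by fun_prop)
  · filter_upwards [ae_restrict_mem measurableSet_Ioo] with ρ hρ
    exact (hC _ (hmaps hρ).1 (hmaps hρ).2).1.hasSum.tendsto_sum_nat

theorem ofReal_ne_neg_natCast {c : ℝ} (hc : 0 < c) (m : ℕ) : (c : ℂ) ≠ -m := by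
  intro h
  have h' := congrArg Complex.re h
  simp only [Complex.ofReal_re, Complex.neg_re, Complex.natCast_re] at h'
  have : (0 : ℝ) ≤ m := m.cast_nonneg
  linarith

theorem thetaJ_estimates {p q : ℝ} {α : ℂ} (hp : -1 < p) (hα : α.re = 0)
    {ε : ℝ} (hε : 0 < ε) :
    (∃ C : ℝ, 0 ≤ C ∧ ∀ x : ℝ, 0 < x → x < 1 →
      ‖thetaJ p q α x‖ ≤ C * x ^ ((1 + p + q) / 2 - ε)) ∧
    ∀ g : ℝ → ℝ, Measurable g → MapsTo g (Ioo 0 1) (Ioo 0 1) →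
      AEStronglyMeasurable (fun ρ => thetaJ p q α (g ρ)) (volume.restrict (Ioo 0 1)) := by
  have hc : ∀ m : ℕ, (1 + p : ℂ) ≠ -m := fun m => by
    simpa using ofReal_ne_neg_natCast (c := 1 + p) (by linarith) m
  have hre1 : ((1 + p + q : ℂ) / 2 + α).re = (1 + p + q) / 2 := by
    have : (1 + p + q : ℂ) / 2 = (((1 + p + q) / 2 : ℝ) : ℂ) := by push_cast; rfl
    rw [Complex.add_re, hα, this, Complex.ofReal_re, add_zero]
  have hre2 : ((1 + p - q : ℂ) / 2 + α).re = (1 + p - q) / 2 := by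
    have : (1 + p - q : ℂ) / 2 = (((1 + p - q) / 2 : ℝ) : ℂ) := by push_cast; rfl
    rw [Complex.add_re, hα, this, Complex.ofReal_re, add_zero]
  have habc : ((1 + p + q : ℂ) / 2 + α).re + ((1 + p - q : ℂ) / 2 + α).re = (1 + p : ℂ).re := by
    rw [hre1, hre2]; simp; ring
  constructor
  · obtain ⟨C, hC0, hC⟩ := hyp2F1_balanced_rpow_bound _ _ _ hc habc hε
    refine ⟨C, hC0, fun x hx0 hx1 => ?_⟩
    have h := hC (1 - x) (by linarith) (by linarith)
    rw [sub_sub_cancel, Complex.ofReal_sub, Complex.ofReal_one] at h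
    rw [thetaJ, norm_mul, Complex.norm_cpow_eq_rpow_re_of_pos hx0, hre1, sub_eq_add_neg _ ε,
      Real.rpow_add hx0]
    calc _ ≤ x ^ ((1 + p + q) / 2) * (C * x ^ (-ε)) := by gcongr
      _ = _ := by ring
  · intro g hg hmaps
    have hF := aestronglyMeasurable_hyp2F1_balanced _ _ _ hc habc
      (g := fun ρ => 1 - g ρ) (by fun_prop)
      (fun ρ hρ => ⟨by linarith [(hmaps hρ).2], by linarith [(hmaps hρ).1]⟩)
    simp only [Complex.ofReal_sub, Complex.ofReal_one] at hF
    have hpow : Measurable (fun ρ : ℝ => ((g ρ : ℝ) : ℂ) ^ ((1 + p + q : ℂ) / 2 + α)) := by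
      fun_prop
    exact hpow.aestronglyMeasurable.mul hF

theorem norm_ofReal_cpow_ofReal {x : ℝ} (hx : 0 < x) (s : ℝ) :
    ‖(x : ℂ) ^ (s : ℂ)‖ = x ^ s := by
  rw [Complex.norm_cpow_eq_rpow_re_of_pos hx, Complex.ofReal_re]

theorem integrableOn_rpow_mul_one_sub_rpow {s t : ℝ} (hs : -1 < s) (ht : -1 < t) :
    IntegrableOn (fun x : ℝ => x ^ s * (1 - x) ^ t) (Ioo 0 1) := by
  have h := Complex.betaIntegral_convergent (u := ((s + 1 : ℝ) : ℂ)) (v := ((t + 1 : ℝ) : ℂ))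
    (by rw [Complex.ofReal_re]; linarith) (by rw [Complex.ofReal_re]; linarith)
  rw [intervalIntegrable_iff_integrableOn_Ioo_of_le zero_le_one] at h
  refine IntegrableOn.congr_fun h.norm (fun x hx => ?_) measurableSet_Ioo
  have h1 : 0 < 1 - x := sub_pos.2 hx.2
  have e1 : ((s + 1 : ℝ) : ℂ) - 1 = (s : ℂ) := by push_cast; ring
  have e2 : ((t + 1 : ℝ) : ℂ) - 1 = (t : ℂ) := by push_cast; ring
  have e3 : (1 : ℂ) - x = ((1 - x : ℝ) : ℂ) := by push_cast; rfl
  simp only [e1, e2, e3, norm_mul, norm_ofReal_cpow_ofReal hx.1, norm_ofReal_cpow_ofReal h1]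

theorem wbulk_mul_eq_wbdy_mul (h s : ℝ) {ρ : ℝ} (hρ : ρ ∈ Ioo (0 : ℝ) 1) :
    wbulk h ρ * ((ρ / (1 - ρ) : ℝ) : ℂ) ^ (s : ℂ) =
      wbdy h ρ * (((1 - ρ) / ρ : ℝ) : ℂ) ^ ((2 * h - s : ℝ) : ℂ) := by
  have h0 : 0 < ρ := hρ.1
  have h1 : 0 < 1 - ρ := sub_pos.2 hρ.2
  have h2 : 0 < ρ / (1 - ρ) := div_pos h0 h1
  have h3 : 0 < (1 - ρ) / ρ := div_pos h1 h0
  rw [wbulk, wbdy, ← Complex.ofReal_cpow h0.le, ← Complex.ofReal_cpow h0.le,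
    ← Complex.ofReal_cpow h1.le, ← Complex.ofReal_cpow h2.le, ← Complex.ofReal_cpow h3.le,
    ← Complex.ofReal_mul, ← Complex.ofReal_mul, ← Complex.ofReal_mul]
  congr 1
  rw [Real.rpow_def_of_pos h0, Real.rpow_def_of_pos h0, Real.rpow_def_of_pos h1,
    Real.rpow_def_of_pos h2, Real.rpow_def_of_pos h3, Real.log_div h0.ne' h1.ne',
    Real.log_div h1.ne' h0.ne', ← Real.exp_add, ← Real.exp_add, ← Real.exp_add]
  congr 1
  ring

theorem integrableOn_bulk_kernel {h Δp Δm : ℝ} (hh : 0 < h) (h1 : -(1 / 2) < Δm)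
    (h2 : h / 2 < Δp) (h3 : Δp - Δm < h + 1 / 2)
    {α ν : ℂ} (hα : α.re = 0) (hν : ν.re = 0) :
    IntegrableOn (fun ρ : ℝ =>
        wbulk h ρ * ((ρ / (1 - ρ) : ℝ) : ℂ) ^ ((Δp : ℝ) : ℂ) *
          PsiBulk h Δm α ρ * PsiBdy h ν ρ) (Ioo 0 1) := by
  obtain ⟨ε, hε, hεs⟩ := exists_between
    (show 0 < min (Δp - h / 2) (h + 1 / 2 - (Δp - Δm)) from
      lt_min (by linarith) (by linarith))
  obtain ⟨hε1, hε2⟩ := lt_min_iff.1 hεs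
  obtain ⟨⟨A, hA0, hA⟩, hAm⟩ := thetaJ_estimates (p := 2 * Δm) (q := h - 1) (by linarith) hα hε
  obtain ⟨⟨B, hB0, hB⟩, hBm⟩ := thetaJ_estimates (p := h - 1) (q := h - 1) (by linarith) hν hε
  have hI := (integrableOn_rpow_mul_one_sub_rpow (s := Δp - h / 2 - 1 - ε)
    (t := Δm - Δp + h - 1 / 2 - ε) (by linarith) (by linarith)).const_mul (A * B)
  refine Integrable.mono' hI ?_ ?_
  · have m1 : Measurable (fun ρ : ℝ =>
        wbulk h ρ * ((ρ / (1 - ρ) : ℝ) : ℂ) ^ ((Δp : ℝ) : ℂ)) := by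
      unfold wbulk; fun_prop
    have m2 : Measurable (fun ρ : ℝ => (((1 - ρ) / ρ : ℝ) : ℂ) ^ ((Δm : ℝ) : ℂ)) := by
      fun_prop
    exact (m1.aestronglyMeasurable.mul (m2.aestronglyMeasurable.mul
      (hAm id measurable_id (mapsTo_id _)))).mul
      (hBm (fun ρ => 1 - ρ) (by fun_prop)
        fun ρ hρ => ⟨by linarith [hρ.2], by linarith [hρ.1]⟩)
  · filter_upwards [ae_restrict_mem measurableSet_Ioo] with ρ hρ
    have r0 : 0 < ρ := hρ.1
    have r1 : 0 < 1 - ρ := sub_pos.2 hρ.2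
    have r2 : 0 < ρ / (1 - ρ) := div_pos r0 r1
    have r3 : 0 < (1 - ρ) / ρ := div_pos r1 r0
    rw [PsiBulk, PsiBdy, wbulk]
    simp only [norm_mul, norm_ofReal_cpow_ofReal r0, norm_ofReal_cpow_ofReal r2,
      norm_ofReal_cpow_ofReal r3]
    calc _ ≤ ρ ^ (-h - 1) * (ρ / (1 - ρ)) ^ Δp *
          (((1 - ρ) / ρ) ^ Δm * (A * ρ ^ ((1 + 2 * Δm + (h - 1)) / 2 - ε))) *
          (B * (1 - ρ) ^ ((1 + (h - 1) + (h - 1)) / 2 - ε)) := by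
          gcongr
          · exact hA ρ r0 hρ.2
          · exact hB (1 - ρ) r1 (by linarith)
      _ = A * B * (ρ ^ (-h - 1) * (ρ / (1 - ρ)) ^ Δp *
          (((1 - ρ) / ρ) ^ Δm * ρ ^ ((1 + 2 * Δm + (h - 1)) / 2 - ε)) *
          (1 - ρ) ^ ((1 + (h - 1) + (h - 1)) / 2 - ε)) := by ring
      _ = _ := by
          congr 1
          simp only [Real.rpow_def_of_pos r0, Real.rpow_def_of_pos r1, Real.rpow_def_of_pos r2,
            Real.rpow_def_of_pos r3, Real.log_div r0.ne' r1.ne', Real.log_div r1.ne' r0.ne',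
            ← Real.exp_add]
          congr 1
          ring

theorem stmt14 (d Δ₁ Δ₂ h Δp Δm : ℝ)
    (hh : h = d / 2) (hΔp : Δp = (Δ₁ + Δ₂) / 2) (hΔm : Δm = (Δ₁ - Δ₂) / 2)
    (hd : 0 < d) (h1 : -(1 / 2) < Δm) (h2 : h / 2 < Δp) (h3 : Δ₂ < h + 1 / 2)
    (α ν : ℂ) (hα : α.re = 0) (hν : ν.re = 0) :
    IntegrableOn (fun ρ : ℝ =>
        wbulk h ρ * ((ρ / (1 - ρ) : ℝ) : ℂ) ^ ((Δp : ℝ) : ℂ) *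
          PsiBulk h Δm α ρ * PsiBdy h ν ρ) (Ioo 0 1) ∧
    IntegrableOn (fun ρ : ℝ =>
        wbdy h ρ * (((1 - ρ) / ρ : ℝ) : ℂ) ^ ((d - Δp : ℝ) : ℂ) *
          PsiBulk h Δm α ρ * PsiBdy h ν ρ) (Ioo 0 1) ∧
    ∫ ρ in Ioo (0 : ℝ) 1,
        wbulk h ρ * ((ρ / (1 - ρ) : ℝ) : ℂ) ^ ((Δp : ℝ) : ℂ) *
          PsiBulk h Δm α ρ * PsiBdy h ν ρ
      = ∫ ρ in Ioo (0 : ℝ) 1,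
          wbdy h ρ * (((1 - ρ) / ρ : ℝ) : ℂ) ^ ((d - Δp : ℝ) : ℂ) *
            PsiBulk h Δm α ρ * PsiBdy h ν ρ := by
  have hd' : d = 2 * h := by linarith
  have hI := integrableOn_bulk_kernel (h := h) (Δp := Δp) (Δm := Δm) (by linarith) h1 h2
    (by linarith) hα hν
  have heq : EqOn (fun ρ : ℝ =>
        wbulk h ρ * ((ρ / (1 - ρ) : ℝ) : ℂ) ^ ((Δp : ℝ) : ℂ) *
          PsiBulk h Δm α ρ * PsiBdy h ν ρ)
      (fun ρ : ℝ =>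
        wbdy h ρ * (((1 - ρ) / ρ : ℝ) : ℂ) ^ ((d - Δp : ℝ) : ℂ) *
          PsiBulk h Δm α ρ * PsiBdy h ν ρ) (Ioo 0 1) := fun ρ hρ => by
    simp only [wbulk_mul_eq_wbdy_mul h Δp hρ, hd']
  exact ⟨hI, hI.congr_fun heq measurableSet_Ioo, setIntegral_congr_fun measurableSet_Ioo heq⟩
end
end
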